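/- (Linear rate in the strongly convex case.) Let f : ℝⁿ → ℝ be L-smooth and μ-strongly convex with 0 < μ ≤ L, and let x_* be a global minimizer of f. Let c ∈ (0, 1/2), τ ∈ (0,1), β̄ > 0, u_g > 0, u_p > 0, κ ∈ (0, 1]. Let x_0, x_1, x_2, … be a sequence in ℝⁿ and S ⊆ ℕ such that: for every i ∈ S there exist β_i ∈ (0, β̄], g_i ∈ ℝⁿ, and p_i ∈ ℝⁿ with p_i ≠ 0 satisfying x_{i+1} = x_i + β_i p_i, ‖∇f(x_i) − g_i‖ ≤ u_g β_i ‖g_i‖, ⟨−g_i, p_i⟩ > κ ‖g_i‖ ‖p_i‖, ‖g_i‖ ≤ u_p ‖p_i‖, f(x_i + β_i p_i) ≤ f(x_i) + c β_i ⟨g_i, p_i⟩, and either β_i = β̄ or f(x_i + (β_i/τ) p_i) − f(x_i) > c (β_i/τ) ⟨g_i, p_i⟩; and for every i ∉ S, f(x_{i+1}) ≤ f(x_i). Then for every k ≥ 0, f(x_k) − f(x_*) ≤ (1 − η_μ)^{ns_k} (f(x_0) − f(x_*)), where ns_k = |S ∩ {0, …, k−1}| and η_μ = (2 μ c / (β̄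 u_g + 1)²) · min{ β̄ κ / u_p, 2 τ κ² (1 − c) / (2 u_g u_p + L) }; moreover η_μ ∈ (0,1). -/

import Mathlib

open scoped RealInnerProductSpace

/-- The descent lemma for functions with Lipschitz gradient. -/
lemma descent_aux {n : ℕ} (f : EuclideanSpace ℝ (Fin n) → ℝ) (L : ℝ)
    (hdiff : Differentiable ℝ f)
    (hlip : ∀ y z : EuclideanSpace ℝ (Fin n),
      ‖gradient f y - gradient f z‖ ≤ L * ‖y - z‖)
    (x d : EuclideanSpace ℝ (Fin n)) :
    f (x + d) ≤ f x + ⟪gradient f x, d⟫ + L / 2 * ‖d‖ ^ 2 := by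
  have hd : ∀ t : ℝ, HasDerivAt
      (fun t : ℝ => f (x + t • d) - t * ⟪gradient f x, d⟫ - L / 2 * ‖d‖ ^ 2 * t ^ 2)
      (⟪gradient f (x + t • d), d⟫ - ⟪gradient f x, d⟫ - L * ‖d‖ ^ 2 * t) t := by
    intro t
    have h1 : HasDerivAt (fun t : ℝ => x + t • d) d t := by
      simpa using ((hasDerivAt_id t).smul_const d).const_add x
    have h2 := ((hdiff (x + t • d)).hasGradientAt.hasFDerivAt).comp_hasDerivAt t h1
    have h3 := (h2.sub ((hasDerivAt_id t).mul_const ⟪gradient f x, d⟫)).sub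
      (((hasDerivAt_id t).pow 2).const_mul (L / 2 * ‖d‖ ^ 2))
    refine h3.congr_deriv ?_
    simp
    ring
  have hanti : AntitoneOn
      (fun t : ℝ => f (x + t • d) - t * ⟪gradient f x, d⟫ - L / 2 * ‖d‖ ^ 2 * t ^ 2)
      (Set.Icc 0 1) := by
    apply antitoneOn_of_deriv_nonpos (convex_Icc 0 1)
    · exact fun t _ => (hd t).continuousAt.continuousWithinAt
    · exact fun t _ => (hd t).differentiableAt.differentiableWithinAt
    · intro t ht
      rw [interior_Icc] at ht
      rw [(hd t).deriv, ← inner_sub_left]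
      have h1 := real_inner_le_norm (gradient f (x + t • d) - gradient f x) d
      have h2 := hlip (x + t • d) x
      rw [add_sub_cancel_left, norm_smul, Real.norm_of_nonneg ht.1.le] at h2
      have h3 := mul_le_mul_of_nonneg_right h2 (norm_nonneg d)
      nlinarith
  have := hanti (Set.left_mem_Icc.2 zero_le_one) (Set.right_mem_Icc.2 zero_le_one) zero_le_one
  simp only [one_smul, zero_smul, add_zero, one_mul, zero_mul, one_pow, mul_one] at this
  linarith

/-- The Polyak-Lojasiewicz inequality from strong convexity. -/
lemma pl_aux {n : ℕ} (f : EuclideanSpace ℝ (Fin n) → ℝ) (μ : ℝ) (hμ : 0 < μ)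
    (hsc : ∀ x y : EuclideanSpace ℝ (Fin n),
      f y ≥ f x + ⟪gradient f x, y - x⟫ + μ / 2 * ‖y - x‖ ^ 2)
    (x y : EuclideanSpace ℝ (Fin n)) :
    2 * μ * (f x - f y) ≤ ‖gradient f x‖ ^ 2 := by
  have h := hsc x y
  have h1 := neg_le_of_abs_le (abs_real_inner_le_norm (gradient f x) (y - x))
  nlinarith [sq_nonneg (‖gradient f x‖ - μ * ‖y - x‖)]

set_option maxHeartbeats 1000000

/-- Linear rate in the strongly convex case:
`f(x_k) − f(x_*) ≤ (1 − η_μ)^{ns_k} (f(x₀) − f(x_*))` with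
`η_μ = (2μc/(β̄ u_g + 1)²) min{β̄κ/u_p, 2τκ²(1−c)/(2 u_g u_p + L)} ∈ (0,1)`. -/
theorem full_low_eval_linear_rate_strongly_convex {n : ℕ}
    (f : EuclideanSpace ℝ (Fin n) → ℝ) (L μ : ℝ) (hμ : 0 < μ) (hμL : μ ≤ L)
    (hdiff : Differentiable ℝ f)
    (hlip : ∀ y z : EuclideanSpace ℝ (Fin n),
      ‖gradient f y - gradient f z‖ ≤ L * ‖y - z‖)
    (hsc : ∀ x y : EuclideanSpace ℝ (Fin n),
      f y ≥ f x + ⟪gradient f x, y - x⟫ + μ / 2 * ‖y - x‖ ^ 2)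
    (xstar : EuclideanSpace ℝ (Fin n)) (hmin : ∀ y, f xstar ≤ f y)
    (c τ βbar u_g u_p κ : ℝ)
    (hc : 0 < c) (hc12 : c < 1 / 2) (hτ : 0 < τ) (hτ1 : τ < 1)
    (hβbar : 0 < βbar) (hug : 0 < u_g) (hup : 0 < u_p) (hκ : 0 < κ) (hκ1 : κ ≤ 1)
    (x : ℕ → EuclideanSpace ℝ (Fin n)) (S : Set ℕ)
    (hsucc : ∀ i ∈ S, ∃ (β : ℝ) (g p : EuclideanSpace ℝ (Fin n)),
      0 < β ∧ β ≤ βbar ∧ p ≠ 0 ∧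
      x (i + 1) = x i + β • p ∧
      ‖gradient f (x i) - g‖ ≤ u_g * β * ‖g‖ ∧
      ⟪-g, p⟫ > κ * (‖g‖ * ‖p‖) ∧
      ‖g‖ ≤ u_p * ‖p‖ ∧
      f (x i + β • p) ≤ f (x i) + c * β * ⟪g, p⟫ ∧
      (β = βbar ∨ f (x i + (β / τ) • p) - f (x i) > c * (β / τ) * ⟪g, p⟫))
    (hother : ∀ i, i ∉ S → f (x (i + 1)) ≤ f (x i))
    (ημ : ℝ)
    (hη : ημ = 2 * μ * c / (βbar * u_g + 1) ^ 2 *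
      min (βbar * κ / u_p) (2 * τ * κ ^ 2 * (1 - c) / (2 * u_g * u_p + L))) :
    (∀ k : ℕ,
      f (x k) - f xstar ≤
        (1 - ημ) ^ ((S ∩ Set.Iio k).ncard) * (f (x 0) - f xstar)) ∧
    0 < ημ ∧ ημ < 1 := by
  have hL : 0 < L := lt_of_lt_of_le hμ hμL
  have hD : 0 < 2 * u_g * u_p + L := by positivity
  have h1c : 0 < 1 - c := by linarith
  have hB : 1 < βbar * u_g + 1 := by linarith [mul_pos hβbar hug]
  have hB2 : 1 < (βbar * u_g + 1) ^ 2 := by nlinarith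
  set M := min (βbar * κ / u_p) (2 * τ * κ ^ 2 * (1 - c) / (2 * u_g * u_p + L)) with hM
  have hMpos : 0 < M := lt_min (by positivity) (by positivity)
  have hηpos : 0 < ημ := by rw [hη]; positivity
  have hη1 : ημ < 1 := by
    have e1 : M * L ≤ 2 * (1 - c) := by
      have e2 : M ≤ 2 * τ * κ ^ 2 * (1 - c) / (2 * u_g * u_p + L) := min_le_right _ _
      rw [le_div_iff₀ hD] at e2
      have e3 : M * L ≤ M * (2 * u_g * u_p + L) :=
        mul_le_mul_of_nonneg_left (by nlinarith [mul_pos hug hup]) hMpos.le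
      have e4 : τ * κ ^ 2 ≤ 1 := by
        have : κ ^ 2 ≤ 1 := by nlinarith
        nlinarith
      nlinarith
    have e5 : μ * M ≤ 2 * (1 - c) := by nlinarith
    rw [hη, div_mul_eq_mul_div, div_lt_one (by positivity)]
    nlinarith [sq_nonneg (1 - 2 * c)]
  refine ⟨?_, hηpos, hη1⟩
  have step : ∀ i ∈ S, f (x (i + 1)) - f xstar ≤ (1 - ημ) * (f (x i) - f xstar) := by
    intro i hi
    obtain ⟨β, g, p, hβ, hββ, hp, hx, hg, hcos, hgp, harm, hor⟩ := hsucc i hi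
    have hP : 0 < ‖p‖ := norm_pos_iff.2 hp
    have hG : 0 ≤ ‖g‖ := norm_nonneg g
    rw [inner_neg_left] at hcos
    -- the key lower bound
    have key : M * ‖g‖ ^ 2 ≤ β * (κ * (‖g‖ * ‖p‖)) := by
      rcases hor with h | h
      · have e : M ≤ βbar * κ / u_p := min_le_left _ _
        rw [le_div_iff₀ hup] at e
        have e1 : M * ‖g‖ ≤ M * (u_p * ‖p‖) := mul_le_mul_of_nonneg_left hgp hMpos.le
        have e2 : M * u_p * ‖p‖ ≤ βbar * κ * ‖p‖ := mul_le_mul_of_nonneg_right e hP.le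
        have e3 : M * ‖g‖ ≤ βbar * κ * ‖p‖ := by linarith
        have e4 := mul_le_mul_of_nonneg_right e3 hG
        rw [h]; linarith
      · have hdesc := descent_aux f L hdiff hlip (x i) ((β / τ) • p)
        rw [inner_smul_right, norm_smul, Real.norm_of_nonneg (by positivity)] at hdesc
        obtain ⟨t, ht⟩ : ∃ t, t = β / τ := ⟨_, rfl⟩
        rw [← ht] at h hdesc
        have htβ : t * τ = β := by rw [ht]; field_simp
        have htp : 0 < t := by rw [ht]; positivity
        have hβt : β ≤ t := by nlinarith
        have hi1 := real_inner_le_norm (gradient f (x i) - g) p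
        rw [inner_sub_left] at hi1
        have hi2 : ‖gradient f (x i) - g‖ * ‖p‖ ≤ u_g * β * ‖g‖ * ‖p‖ :=
          mul_le_mul_of_nonneg_right hg hP.le
        have hi3 : u_g * β * ‖g‖ * ‖p‖ ≤ u_g * t * (u_p * ‖p‖) * ‖p‖ := by gcongr
        have hA : t * (c * ⟪g, p⟫) < t * (⟪gradient f (x i), p⟫ + L / 2 * t * ‖p‖ ^ 2) := by
          linarith
        have hA' := lt_of_mul_lt_mul_left hA htp.le
        have hA2 : (1 - c) * (κ * (‖g‖ * ‖p‖)) ≤ (1 - c) * (-⟪g, p⟫) :=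
          mul_le_mul_of_nonneg_left hcos.le h1c.le
        have hA3 : (2 * (1 - c) * κ * ‖g‖) * ‖p‖ ≤ (t * ‖p‖ * (2 * u_g * u_p + L)) * ‖p‖ := by
          linarith
        have hA4 := le_of_mul_le_mul_right hA3 hP
        have e : M ≤ 2 * τ * κ ^ 2 * (1 - c) / (2 * u_g * u_p + L) := min_le_right _ _
        rw [le_div_iff₀ hD] at e
        have e1 := mul_le_mul_of_nonneg_right e (sq_nonneg ‖g‖)
        have e2 := mul_le_mul_of_nonneg_left hA4 (show 0 ≤ τ * κ * ‖g‖ by positivity)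
        refine le_of_mul_le_mul_right ?_ hD
        rw [← htβ]
        linarith
    have hgrad : ‖gradient f (x i)‖ ≤ (βbar * u_g + 1) * ‖g‖ := by
      have e1 := norm_le_norm_sub_add (gradient f (x i)) g
      have e2 : u_g * β * ‖g‖ ≤ u_g * βbar * ‖g‖ := by gcongr
      linarith
    have hgrad2 : ‖gradient f (x i)‖ ^ 2 ≤ (βbar * u_g + 1) ^ 2 * ‖g‖ ^ 2 := by
      rw [← mul_pow]; gcongr
    have hpl := pl_aux f μ hμ hsc (x i) xstar
    have hfin : ημ * (f (x i) - f xstar) ≤ c * (M * ‖g‖ ^ 2) := by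
      have e1 : ημ * (f (x i) - f xstar)
          = c * M * (2 * μ * (f (x i) - f xstar)) / (βbar * u_g + 1) ^ 2 := by
        rw [hη]; ring
      rw [e1, div_le_iff₀ (by positivity)]
      have := mul_le_mul_of_nonneg_left (hpl.trans hgrad2) (mul_pos hc hMpos).le
      linarith
    have hk2 := mul_le_mul_of_nonneg_left key hc.le
    have hk3 := mul_le_mul_of_nonneg_left hcos.le (mul_pos hc hβ).le
    rw [hx]
    linarith
  intro k
  induction k with
  | zero => simp
  | succ k ih =>
    by_cases hk : k ∈ S
    · have e : S ∩ Set.Iio (k + 1) = insert k (S ∩ Set.Iio k) := by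
        ext j
        simp only [Set.mem_inter_iff, Set.mem_Iio, Set.mem_insert_iff]
        constructor
        · rintro ⟨h1, h2⟩
          by_cases hj : j = k
          · exact Or.inl hj
          · exact Or.inr ⟨h1, by omega⟩
        · rintro (h | ⟨h1, h2⟩)
          · subst h; exact ⟨hk, by omega⟩
          · exact ⟨h1, by omega⟩
      rw [e, Set.ncard_insert_of_notMem (by simp) ((Set.finite_Iio k).inter_of_right S), pow_succ']
      have h1 := step k hk
      have h2 := mul_le_mul_of_nonneg_left ih (show 0 ≤ 1 - ημ by linarith)
      linarith
    · have e : S ∩ Set.Iio (k + 1) = S ∩ Set.Iio k := by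
        ext j
        simp only [Set.mem_inter_iff, Set.mem_Iio]
        constructor
        · rintro ⟨h1, h2⟩
          have : j ≠ k := fun h => hk (h ▸ h1)
          exact ⟨h1, by omega⟩
        · rintro ⟨h1, h2⟩
          exact ⟨h1, by omega⟩
      rw [e]
      linarith [hother k hk]
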